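/- For each n ∈ ℕ, WR(Σ_n ∧ Π_n) proves IΣ_{n+1}: every model of IΔ0 satisfying the weak regularity principle for all conjunctions of a Σ_n and a Π_n formula satisfies Σ_{n+1}-induction. Moreover, for each k ≤ n, IΣ_k + WR(Σ_n ∧ Π_n) proves IΣ_{k+1}. -/

import Mathlib

namespace PaperArith

/-! ## Syntax of (two-sorted) first-order arithmetic

Terms and formulas of arithmetic in the language `{0, 1, +, ·, <}`,
with number variables and (monadic second-order) set variables both indexed
by natural numbers.  Bounded quantifiers are taken as primitives, so that the
class `Δ₀` of bounded formulas is a purely syntactic class. -/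

/-- Terms of first-order arithmetic in the language `{0, 1, +, ·, <}`. -/
inductive Term : Type
  | var : ℕ → Term
  | zero : Term
  | one : Term
  | add : Term → Term → Term
  | mul : Term → Term → Term

/-- Formulas of (two-sorted) arithmetic.  `mem t i` is the atomic formula
`t ∈ Xᵢ`; `ball x t φ` is `∀ x < t, φ` and `bex x t φ` is `∃ x < t, φ`;
`sall i φ` and `sex i φ` quantify over the set variable `Xᵢ`.
Purely first-order formulas are those avoiding `mem`, `sall`, `sex`. -/
inductive Fml : Type
  | eq : Term → Term → Fml
  | lt : Term → Term → Fml
  | mem : Term → ℕ → Fml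
  | not : Fml → Fml
  | and : Fml → Fml → Fml
  | or : Fml → Fml → Fml
  | imp : Fml → Fml → Fml
  | all : ℕ → Fml → Fml
  | ex : ℕ → Fml → Fml
  | ball : ℕ → Term → Fml → Fml
  | bex : ℕ → Term → Fml → Fml
  | sall : ℕ → Fml → Fml
  | sex : ℕ → Fml → Fml

/-- A structure for the first-order language of arithmetic. -/
structure Str : Type 1 where
  M : Type
  zero : M
  one : M
  add : M → M → M
  mul : M → M → M
  lt : M → M → Prop

/-- Value of a term under a valuation of the number variables. -/
def tval (S : Str) (v : ℕ → S.M) : Term → S.M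
  | .var i => v i
  | .zero => S.zero
  | .one => S.one
  | .add t u => S.add (tval S v t) (tval S v u)
  | .mul t u => S.mul (tval S v t) (tval S v u)

/-- Update a valuation at one variable. -/
def upd {α : Type} (v : ℕ → α) (x : ℕ) (a : α) : ℕ → α :=
  fun i => if i = x then a else v i

/-- Tarskian satisfaction over the structure `S`, with second-order universe
`X` (set quantifiers range over `X`); `v` is the valuation of number
variables, `w` the valuation of set variables. -/
def Sat (S : Str) (X : Set (Set S.M)) : (ℕ → S.M) → (ℕ → Set S.M) → Fml → Prop
  | v, _, .eq t u => tval S v t = tval S v u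
  | v, _, .lt t u => S.lt (tval S v t) (tval S v u)
  | v, w, .mem t i => tval S v t ∈ w i
  | v, w, .not φ => ¬ Sat S X v w φ
  | v, w, .and φ ψ => Sat S X v w φ ∧ Sat S X v w ψ
  | v, w, .or φ ψ => Sat S X v w φ ∨ Sat S X v w ψ
  | v, w, .imp φ ψ => Sat S X v w φ → Sat S X v w ψ
  | v, w, .all x φ => ∀ m : S.M, Sat S X (upd v x m) w φ
  | v, w, .ex x φ => ∃ m : S.M, Sat S X (upd v x m) w φ
  | v, w, .ball x t φ => ∀ m : S.M, S.lt m (tval S v t) → Sat S X (upd v x m) w φ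
  | v, w, .bex x t φ => ∃ m : S.M, S.lt m (tval S v t) ∧ Sat S X (upd v x m) w φ
  | v, w, .sall i φ => ∀ A : Set S.M, A ∈ X → Sat S X v (upd w i A) φ
  | v, w, .sex i φ => ∃ A : Set S.M, A ∈ X ∧ Sat S X v (upd w i A) φ

/-- First-order satisfaction (for purely first-order formulas the second-order
data is irrelevant). -/
def Sat0 (S : Str) (v : ℕ → S.M) (φ : Fml) : Prop :=
  Sat S ∅ v (fun _ => ∅) φ

/-! ## The arithmetic hierarchy -/

/-- `Δ₀` formulas: purely first-order, only bounded quantifiers. -/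
inductive Delta0 : Fml → Prop
  | eq (t u : Term) : Delta0 (.eq t u)
  | lt (t u : Term) : Delta0 (.lt t u)
  | not {φ : Fml} : Delta0 φ → Delta0 (.not φ)
  | and {φ ψ : Fml} : Delta0 φ → Delta0 ψ → Delta0 (.and φ ψ)
  | or {φ ψ : Fml} : Delta0 φ → Delta0 ψ → Delta0 (.or φ ψ)
  | imp {φ ψ : Fml} : Delta0 φ → Delta0 ψ → Delta0 (.imp φ ψ)
  | ball (x : ℕ) (t : Term) {φ : Fml} : Delta0 φ → Delta0 (.ball x t φ)
  | bex (x : ℕ) (t : Term) {φ : Fml} : Delta0 φ → Delta0 (.bex x t φ)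

mutual
  /-- `Σₙ` formulas of the first-order arithmetic hierarchy. -/
  inductive IsSigma : ℕ → Fml → Prop
    | delta0 {n : ℕ} {φ : Fml} : Delta0 φ → IsSigma n φ
    | ofPi {n : ℕ} {φ : Fml} : IsPi n φ → IsSigma (n + 1) φ
    | ex (x : ℕ) {n : ℕ} {φ : Fml} : IsSigma (n + 1) φ → IsSigma (n + 1) (.ex x φ)
  /-- `Πₙ` formulas of the first-order arithmetic hierarchy. -/
  inductive IsPi : ℕ → Fml → Prop
    | delta0 {n : ℕ} {φ : Fml} : Delta0 φ → IsPi n φ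
    | ofSigma {n : ℕ} {φ : Fml} : IsSigma n φ → IsPi (n + 1) φ
    | all (x : ℕ) {n : ℕ} {φ : Fml} : IsPi (n + 1) φ → IsPi (n + 1) (.all x φ)
end

/-- `Σ₀(Σₙ)`: the closure of `Σₙ` under Boolean operations and bounded
quantification. -/
inductive Sigma0Sigma (n : ℕ) : Fml → Prop
  | ofSigma {φ : Fml} : IsSigma n φ → Sigma0Sigma n φ
  | not {φ : Fml} : Sigma0Sigma n φ → Sigma0Sigma n (.not φ)
  | and {φ ψ : Fml} : Sigma0Sigma n φ → Sigma0Sigma n ψ → Sigma0Sigma n (.and φ ψ)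
  | or {φ ψ : Fml} : Sigma0Sigma n φ → Sigma0Sigma n ψ → Sigma0Sigma n (.or φ ψ)
  | imp {φ ψ : Fml} : Sigma0Sigma n φ → Sigma0Sigma n ψ → Sigma0Sigma n (.imp φ ψ)
  | ball (x : ℕ) (t : Term) {φ : Fml} : Sigma0Sigma n φ → Sigma0Sigma n (.ball x t φ)
  | bex (x : ℕ) (t : Term) {φ : Fml} : Sigma0Sigma n φ → Sigma0Sigma n (.bex x t φ)

/-- The class `Σₙ ∧ Πₙ` of conjunctions of a `Σₙ` and a `Πₙ` formula. -/
def SigmaAndPi (n : ℕ) (φ : Fml) : Prop :=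
  ∃ ψ χ : Fml, IsSigma n ψ ∧ IsPi n χ ∧ φ = Fml.and ψ χ

/-- The class `Σₙ ∨ Πₙ` of disjunctions of a `Σₙ` and a `Πₙ` formula. -/
def SigmaOrPi (n : ℕ) (φ : Fml) : Prop :=
  ∃ ψ χ : Fml, IsSigma n ψ ∧ IsPi n χ ∧ φ = Fml.or ψ χ

/-- `Δ₀⁰` formulas of second-order arithmetic: only bounded first-order
quantifiers; free set variables (set parameters) are allowed. -/
inductive Delta0SO : Fml → Prop
  | eq (t u : Term) : Delta0SO (.eq t u)
  | lt (t u : Term) : Delta0SO (.lt t u)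
  | mem (t : Term) (i : ℕ) : Delta0SO (.mem t i)
  | not {φ : Fml} : Delta0SO φ → Delta0SO (.not φ)
  | and {φ ψ : Fml} : Delta0SO φ → Delta0SO ψ → Delta0SO (.and φ ψ)
  | or {φ ψ : Fml} : Delta0SO φ → Delta0SO ψ → Delta0SO (.or φ ψ)
  | imp {φ ψ : Fml} : Delta0SO φ → Delta0SO ψ → Delta0SO (.imp φ ψ)
  | ball (x : ℕ) (t : Term) {φ : Fml} : Delta0SO φ → Delta0SO (.ball x t φ)
  | bex (x : ℕ) (t : Term) {φ : Fml} : Delta0SO φ → Delta0SO (.bex x t φ)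

mutual
  /-- `Σₙ⁰` formulas of the second-order arithmetic hierarchy
  (set parameters allowed, no set quantifiers). -/
  inductive SigmaSO : ℕ → Fml → Prop
    | delta0 {n : ℕ} {φ : Fml} : Delta0SO φ → SigmaSO n φ
    | ofPi {n : ℕ} {φ : Fml} : PiSO n φ → SigmaSO (n + 1) φ
    | ex (x : ℕ) {n : ℕ} {φ : Fml} : SigmaSO (n + 1) φ → SigmaSO (n + 1) (.ex x φ)
  /-- `Πₙ⁰` formulas of the second-order arithmetic hierarchy. -/
  inductive PiSO : ℕ → Fml → Prop
    | delta0 {n : ℕ} {φ : Fml} : Delta0SO φ → PiSO n φ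
    | ofSigma {n : ℕ} {φ : Fml} : SigmaSO n φ → PiSO (n + 1) φ
    | all (x : ℕ) {n : ℕ} {φ : Fml} : PiSO (n + 1) φ → PiSO (n + 1) (.all x φ)
end

/-! ## First-order theories -/

/-- `PA⁻`: the theory of non-negative parts of discretely ordered rings. -/
structure PAminus (S : Str) : Prop where
  add_assoc : ∀ a b c, S.add (S.add a b) c = S.add a (S.add b c)
  add_comm : ∀ a b, S.add a b = S.add b a
  mul_assoc : ∀ a b c, S.mul (S.mul a b) c = S.mul a (S.mul b c)
  mul_comm : ∀ a b, S.mul a b = S.mul b a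
  distrib : ∀ a b c, S.mul a (S.add b c) = S.add (S.mul a b) (S.mul a c)
  add_zero : ∀ a, S.add a S.zero = a
  mul_zero : ∀ a, S.mul a S.zero = S.zero
  mul_one : ∀ a, S.mul a S.one = a
  lt_irrefl : ∀ a, ¬ S.lt a a
  lt_trans : ∀ a b c, S.lt a b → S.lt b c → S.lt a c
  lt_total : ∀ a b, S.lt a b ∨ a = b ∨ S.lt b a
  add_lt_add : ∀ a b c, S.lt a b → S.lt (S.add a c) (S.add b c)
  mul_lt_mul : ∀ a b c, S.lt a b → S.lt S.zero c → S.lt (S.mul a c) (S.mul b c)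
  zero_lt_one : S.lt S.zero S.one
  zero_le : ∀ a, a = S.zero ∨ S.lt S.zero a
  discrete : ∀ a b, S.lt a b → S.add a S.one = b ∨ S.lt (S.add a S.one) b
  pred : ∀ a, S.lt S.zero a → ∃ b, S.add b S.one = a
  sub : ∀ a b, S.lt a b → ∃ c, S.add a c = b

/-- The induction scheme for the class `Γ` of formulas
(parameters are allowed via the ambient valuation `v`). -/
def IndFor (S : Str) (Γ : Fml → Prop) : Prop :=
  ∀ φ : Fml, Γ φ → ∀ (v : ℕ → S.M) (x : ℕ),
    Sat0 S (upd v x S.zero) φ →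
    (∀ m, Sat0 S (upd v x m) φ → Sat0 S (upd v x (S.add m S.one)) φ) →
    ∀ m, Sat0 S (upd v x m) φ

/-- The collection scheme for the class `Γ`:
`(∀ x < a ∃ y φ) → (∃ b ∀ x < a ∃ y < b φ)`. -/
def CollFor (S : Str) (Γ : Fml → Prop) : Prop :=
  ∀ φ : Fml, Γ φ → ∀ (v : ℕ → S.M) (x y : ℕ), x ≠ y → ∀ a : S.M,
    (∀ m, S.lt m a → ∃ k, Sat0 S (upd (upd v x m) y k) φ) →
    ∃ b, ∀ m, S.lt m a → ∃ k, S.lt k b ∧ Sat0 S (upd (upd v x m) y k) φ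

/-- `IΔ₀` (over `PA⁻`). -/
def IDelta0 (S : Str) : Prop := PAminus S ∧ IndFor S Delta0

/-- `IΣₙ` (over `PA⁻`; note `Δ₀ ⊆ Σₙ`, so this includes `IΔ₀`). -/
def ISigma (S : Str) (n : ℕ) : Prop := PAminus S ∧ IndFor S (IsSigma n)

/-- `BΣₙ`: the `Σₙ`-collection scheme, including `IΔ₀` (over `PA⁻`). -/
def BSigma (S : Str) (n : ℕ) : Prop := IDelta0 S ∧ CollFor S (IsSigma n)

/-- The weak regularity principle `WRφ` for all `φ` in the class `Γ`:
the universal closure of `(∀ x ∃ y < a φ(x,y)) → (∃ y < a ∀ b ∃ x > b φ(x,y))`.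
Here `x, y` are the two displayed variables and all other free variables of
`φ` are parameters, interpreted by the ambient valuation `v`. -/
def WRFor (S : Str) (Γ : Fml → Prop) : Prop :=
  ∀ φ : Fml, Γ φ → ∀ (v : ℕ → S.M) (x y : ℕ), x ≠ y → ∀ a : S.M,
    (∀ m, ∃ k, S.lt k a ∧ Sat0 S (upd (upd v x m) y k) φ) →
    ∃ k, S.lt k a ∧ ∀ b, ∃ m, S.lt b m ∧ Sat0 S (upd (upd v x m) y k) φ

/-! ## Second-order theories -/

/-- Second-order induction scheme for the class `Γ`, with set parameters
from the second-order universe `X`. -/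
def IndForSO (S : Str) (X : Set (Set S.M)) (Γ : Fml → Prop) : Prop :=
  ∀ φ : Fml, Γ φ → ∀ (v : ℕ → S.M) (w : ℕ → Set S.M), (∀ i, w i ∈ X) → ∀ x : ℕ,
    Sat S X (upd v x S.zero) w φ →
    (∀ m, Sat S X (upd v x m) w φ → Sat S X (upd v x (S.add m S.one)) w φ) →
    ∀ m, Sat S X (upd v x m) w φ

/-- Second-order collection scheme for the class `Γ`. -/
def CollForSO (S : Str) (X : Set (Set S.M)) (Γ : Fml → Prop) : Prop :=
  ∀ φ : Fml, Γ φ → ∀ (v : ℕ → S.M) (w : ℕ → Set S.M), (∀ i, w i ∈ X) →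
    ∀ (x y : ℕ), x ≠ y → ∀ a : S.M,
    (∀ m, S.lt m a → ∃ k, Sat S X (upd (upd v x m) y k) w φ) →
    ∃ b, ∀ m, S.lt m a → ∃ k, S.lt k b ∧ Sat S X (upd (upd v x m) y k) w φ

/-- `Δ₁⁰`-comprehension. -/
def Delta1CA (S : Str) (X : Set (Set S.M)) : Prop :=
  ∀ φ ψ : Fml, SigmaSO 1 φ → PiSO 1 ψ →
    ∀ (v : ℕ → S.M) (w : ℕ → Set S.M), (∀ i, w i ∈ X) → ∀ x : ℕ,
    (∀ m, Sat S X (upd v x m) w φ ↔ Sat S X (upd v x m) w ψ) →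
    ∃ A ∈ X, ∀ m, m ∈ A ↔ Sat S X (upd v x m) w φ

/-- `Σₙ`-comprehension for first-order formulas with parameters from `M`. -/
def SigmaCA (S : Str) (X : Set (Set S.M)) (n : ℕ) : Prop :=
  ∀ φ : Fml, IsSigma n φ → ∀ (v : ℕ → S.M) (x : ℕ),
    ∃ A ∈ X, ∀ m, m ∈ A ↔ Sat0 S (upd v x m) φ

/-- `RCA₀`. -/
def RCA0 (S : Str) (X : Set (Set S.M)) : Prop :=
  PAminus S ∧ IndForSO S X (SigmaSO 1) ∧ Delta1CA S X

/-- `Σ₁⁰`-separation; over `RCA₀` this is equivalent to weak Kőnig's lemma. -/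
def Sigma1Sep (S : Str) (X : Set (Set S.M)) : Prop :=
  ∀ φ ψ : Fml, SigmaSO 1 φ → SigmaSO 1 ψ →
    ∀ (v : ℕ → S.M) (w : ℕ → Set S.M), (∀ i, w i ∈ X) → ∀ x : ℕ,
    (∀ m, ¬ (Sat S X (upd v x m) w φ ∧ Sat S X (upd v x m) w ψ)) →
    ∃ A ∈ X, ∀ m, (Sat S X (upd v x m) w φ → m ∈ A) ∧ (m ∈ A → ¬ Sat S X (upd v x m) w ψ)

/-- `WKL₀`, rendered as `RCA₀` plus `Σ₁⁰`-separation (which is equivalent,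
over `RCA₀`, to weak Kőnig's lemma). -/
def WKL0 (S : Str) (X : Set (Set S.M)) : Prop := RCA0 S X ∧ Sigma1Sep S X

/-- `BΣₙ⁰`: the second-order `Σₙ⁰`-collection scheme (including `IΔ₀⁰`,
over `PA⁻`). -/
def BSigmaSO (S : Str) (X : Set (Set S.M)) (n : ℕ) : Prop :=
  PAminus S ∧ IndForSO S X Delta0SO ∧ CollForSO S X (SigmaSO n)

/-- `IΣₙ⁰`: the second-order `Σₙ⁰`-induction scheme, over `RCA₀`. -/
def ISigmaSO (S : Str) (X : Set (Set S.M)) (n : ℕ) : Prop :=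
  RCA0 S X ∧ IndForSO S X (SigmaSO n)

/-! ## Exponentiation and binary digits -/

/-- Satisfaction of a three-variable formula `E(x₀, x₁, x₂)` at `(a, b, c)`. -/
def ExpAt (S : Str) (E : Fml) (a b c : S.M) : Prop :=
  Sat0 S (fun i => if i = 0 then a else if i = 1 then b else c) E

/-- `E(x₀,x₁,x₂)` is a `Δ₀` definition of the (total) exponentiation function
`x₀ ^ x₁ = x₂`.  The existence of such an `E` expresses `exp`
(the totality of exponentiation). -/
structure IsExpDef (S : Str) (E : Fml) : Prop where
  delta0 : Delta0 E
  base : ∀ a, ExpAt S E a S.zero S.one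
  total : ∀ a b, ∃ c, ExpAt S E a b c
  unique : ∀ a b c c', ExpAt S E a b c → ExpAt S E a b c' → c = c'
  step : ∀ a b c, ExpAt S E a b c → ExpAt S E a (S.add b S.one) (S.mul c a)

/-- `exp`: the totality of exponentiation (via a `Δ₀` definition of its
graph). -/
def SatExp (S : Str) : Prop := ∃ E : Fml, IsExpDef S E

/-! ## Embeddings, end extensions and elementarity -/

/-- An embedding of arithmetic structures. -/
structure Emb (S K : Str) where
  j : S.M → K.M
  inj : Function.Injective j
  zero : j S.zero = K.zero
  one : j S.one = K.one
  add : ∀ a b, j (S.add a b) = K.add (j a) (j b)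
  mul : ∀ a b, j (S.mul a b) = K.mul (j a) (j b)
  lt_iff : ∀ a b, S.lt a b ↔ K.lt (j a) (j b)

/-- The extension along `e` is an end extension: every element of `K` not in
the image of `M` exceeds every element of `M`. -/
def IsEndExt {S K : Str} (e : Emb S K) : Prop :=
  ∀ b : K.M, b ∉ Set.range e.j → ∀ a : S.M, K.lt (e.j a) b

/-- The extension along `e` is proper. -/
def IsProper {S K : Str} (e : Emb S K) : Prop := ¬ Function.Surjective e.j

/-- The extension along `e` is `Σₙ`-elementary: all `Σₙ` formulas with
parameters from `M` are absolute between `M` and `K`. -/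
def SigmaElem {S K : Str} (e : Emb S K) (n : ℕ) : Prop :=
  ∀ φ : Fml, IsSigma n φ → ∀ v : ℕ → S.M,
    (Sat0 S v φ ↔ Sat0 K (fun i => e.j (v i)) φ)

/-- `K ⊨ M‑IΣₙ` (for an extension `e : M → K`): induction up to any `a ∈ M`
for `Σₙ` formulas with parameters from `K`. -/
def MISigma {S K : Str} (e : Emb S K) (n : ℕ) : Prop :=
  ∀ φ : Fml, IsSigma n φ → ∀ (v : ℕ → K.M) (x : ℕ) (a : S.M),
    Sat0 K (upd v x K.zero) φ →
    (∀ m, K.lt m (e.j a) → (Sat0 K (upd v x m) φ → Sat0 K (upd v x (K.add m K.one)) φ)) →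
    ∀ m, K.lt m (e.j a) → Sat0 K (upd v x m) φ

/-- The `x`-th binary digit of `c ∈ K` is `1`, computed via a `Δ₀` definition
`E` of exponentiation on the ground model `S` (here `x` lies under the image
of `S`): there are `x', p ∈ M` with `j x' = x`, `p = 2 ^ x'`, and `u, v ∈ K`
with `c = u·(2p) + p + v` and `v < p`. -/
def BitVia {S K : Str} (e : Emb S K) (E : Fml) (x c : K.M) : Prop :=
  ∃ x' p : S.M, e.j x' = x ∧ ExpAt S E (S.add S.one S.one) x' p ∧
    ∃ u v : K.M, K.lt v (e.j p) ∧
      c = K.add (K.add (K.mul u (K.add (e.j p) (e.j p))) (e.j p)) v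

/-! ## The second-order restricted ultrapower -/

/-- `A` is cofinal (unbounded) in `S`. -/
def Cofinal (S : Str) (A : Set S.M) : Prop := ∀ b : S.M, ∃ x ∈ A, S.lt b x

/-- The pairing term `⟨x, y⟩ = (x + y)·(x + y) + x`. -/
def pairS (S : Str) (x y : S.M) : S.M := S.add (S.mul (S.add x y) (S.add x y)) x

/-- The graph of `f : M → M`, coded as a subset of `M` via pairing. -/
def graphOf (S : Str) (f : S.M → S.M) : Set S.M := {m | ∃ x, m = pairS S x (f x)}

/-- `f` is a total function `M → M` lying in the second-order universe `X`
(its coded graph belongs to `X`).  The collection of such `f` is the class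
`ℱ` of the restricted ultrapower. -/
def FuncIn (S : Str) (X : Set (Set S.M)) (f : S.M → S.M) : Prop := graphOf S f ∈ X

/-- `U` is an ultrafilter on the Boolean algebra `X`, all of whose elements
are cofinal in `M`. -/
structure UltraOn (S : Str) (X U : Set (Set S.M)) : Prop where
  subset : U ⊆ X
  univ_mem : Set.univ ∈ U
  empty_not_mem : ∅ ∉ U
  inter_mem : ∀ A ∈ U, ∀ B ∈ U, A ∩ B ∈ U
  superset_mem : ∀ A ∈ U, ∀ B ∈ X, A ⊆ B → B ∈ U
  ultra : ∀ A ∈ X, A ∈ U ∨ Aᶜ ∈ U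
  cofinal : ∀ A ∈ U, Cofinal S A

/-- A realization of the second-order restricted ultrapower `ℱ/𝒰` of `S`
with respect to the second-order universe `X` and the ultrafilter `U`:
a structure `K` whose elements are exactly the classes `cls f hf = [f]` of
total functions `f ∈ ℱ`, where `[f] = [g]` iff `f = g` on a set in `U`, with
pointwise arithmetic operations, order decided by `U`, and the inherited
second-order membership relation `memK` serving as the second-order expansion. -/
structure RUP (S : Str) (X U : Set (Set S.M)) : Type 1 where
  K : Str
  cls : (f : S.M → S.M) → FuncIn S X f → K.M
  memK : K.M → Set S.M → Prop
  const_in : ∀ a : S.M, FuncIn S X (fun _ => a)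
  surj : ∀ b : K.M, ∃ (f : S.M → S.M) (hf : FuncIn S X f), cls f hf = b
  eq_iff : ∀ (f : S.M → S.M) (hf : FuncIn S X f) (g : S.M → S.M) (hg : FuncIn S X g),
      (cls f hf = cls g hg) ↔ {i : S.M | f i = g i} ∈ U
  lt_iff : ∀ (f : S.M → S.M) (hf : FuncIn S X f) (g : S.M → S.M) (hg : FuncIn S X g),
      K.lt (cls f hf) (cls g hg) ↔ {i : S.M | S.lt (f i) (g i)} ∈ U
  zero_eq : K.zero = cls (fun _ => S.zero) (const_in S.zero)
  one_eq : K.one = cls (fun _ => S.one) (const_in S.one)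
  add_eq : ∀ (f : S.M → S.M) (hf : FuncIn S X f) (g : S.M → S.M) (hg : FuncIn S X g)
      (h : S.M → S.M) (hh : FuncIn S X h), (∀ i, h i = S.add (f i) (g i)) →
      K.add (cls f hf) (cls g hg) = cls h hh
  mul_eq : ∀ (f : S.M → S.M) (hf : FuncIn S X f) (g : S.M → S.M) (hg : FuncIn S X g)
      (h : S.M → S.M) (hh : FuncIn S X h), (∀ i, h i = S.mul (f i) (g i)) →
      K.mul (cls f hf) (cls g hg) = cls h hh
  mem_iff : ∀ (f : S.M → S.M) (hf : FuncIn S X f) (A : Set S.M), A ∈ X →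
      (memK (cls f hf) A ↔ {i : S.M | f i ∈ A} ∈ U)

/-- The canonical embedding `M → ℱ/𝒰` via constant functions. -/
def RUP.emb {S : Str} {X U : Set (Set S.M)} (R : RUP S X U) (a : S.M) : R.K.M :=
  R.cls (fun _ => a) (R.const_in a)

/-- The subset of `ℱ/𝒰` induced by `A ⊆ M`. -/
def RUP.setImg {S : Str} {X U : Set (Set S.M)} (R : RUP S X U) (A : Set S.M) :
    Set R.K.M := {b | R.memK b A}

/-- The second-order part of the expanded ultrapower `(ℱ/𝒰, 𝒳)`:
the (injected) copy of `X`. -/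
def RUP.X2 {S : Str} {X U : Set (Set S.M)} (R : RUP S X U) : Set (Set R.K.M) :=
  (fun A => R.setImg A) '' X

end PaperArith

namespace PaperArith

/-! ## Semantic arithmetic hierarchy -/

/-- Prepend an element to a valuation. -/
def scons {α : Type} (m : α) (v : ℕ → α) : ℕ → α
  | 0 => m
  | i + 1 => v i

/-- Lift a renaming of variables under a binder. -/
def liftRen (f : ℕ → ℕ) : ℕ → ℕ
  | 0 => 0
  | i + 1 => f i + 1

/-- The renaming that turns the innermost bound variable into the named variable `N`. -/
def unscons (N : ℕ) : ℕ → ℕ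
  | 0 => N
  | i + 1 => i

theorem scons_comp {α : Type} (f : ℕ → ℕ) (m : α) (v : ℕ → α) :
    (fun i => scons m v (liftRen f i)) = scons m (fun i => v (f i)) := by
  funext i; cases i <;> rfl

theorem upd_comp_rename {α : Type} (v : ℕ → α) (x : ℕ) (m : α) :
    (fun i => scons m v (if i = x then 0 else i + 1)) = upd v x m := by
  funext i
  by_cases h : i = x <;> simp [h, upd, scons]

theorem upd_scons_zero {α : Type} (a m : α) (v : ℕ → α) : upd (scons a v) 0 m = scons m v := by
  funext i; cases i <;> simp [upd, scons]

theorem upd_scons_scons {α : Type} (a b m k : α) (v : ℕ → α) :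
    upd (upd (scons a (scons b v)) 0 m) 1 k = scons m (scons k v) := by
  funext i
  rcases i with _ | _ | i <;> simp [upd, scons]

/-- The predicate `R` depends only on the variables below `N`. -/
def SupportedBelow {α : Type} (N : ℕ) (R : (ℕ → α) → Prop) : Prop :=
  ∀ v v' : ℕ → α, (∀ i < N, v i = v' i) → (R v ↔ R v')

theorem SupportedBelow.upd_unscons {α : Type} {N : ℕ} {R : (ℕ → α) → Prop}
    (h : SupportedBelow N R) (v : ℕ → α) (m : α) :
    R (fun i => upd v N m (unscons N i)) ↔ R (scons m v) := by
  apply h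
  rintro (_ | i) hi
  · simp [unscons, upd, scons]
  · have : i ≠ N := by omega
    simp [unscons, upd, scons, this]

theorem tval_support (S : Str) (t : Term) :
    ∃ N, ∀ v v' : ℕ → S.M, (∀ i < N, v i = v' i) → tval S v t = tval S v' t := by
  induction t with
  | var i => exact ⟨i + 1, fun v v' h => h i (by omega)⟩
  | zero => exact ⟨0, fun _ _ _ => rfl⟩
  | one => exact ⟨0, fun _ _ _ => rfl⟩
  | add t u iht ihu =>
    obtain ⟨N, hN⟩ := iht
    obtain ⟨K, hK⟩ := ihu
    refine ⟨max N K, fun v v' h => ?_⟩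
    simp only [tval]
    rw [hN v v' fun i hi => h i (by omega), hK v v' fun i hi => h i (by omega)]
  | mul t u iht ihu =>
    obtain ⟨N, hN⟩ := iht
    obtain ⟨K, hK⟩ := ihu
    refine ⟨max N K, fun v v' h => ?_⟩
    simp only [tval]
    rw [hN v v' fun i hi => h i (by omega), hK v v' fun i hi => h i (by omega)]

theorem upd_agree {α : Type} {N : ℕ} {v v' : ℕ → α} (h : ∀ i < N, v i = v' i) (x : ℕ) (m : α) :
    ∀ i < N, upd v x m i = upd v' x m i := by
  intro i hi
  simp [upd, h i hi]

theorem sat_support (S : Str) (X : Set (Set S.M)) (φ : Fml) :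
    ∃ N, ∀ w, SupportedBelow N fun v => Sat S X v w φ := by
  induction φ with
  | eq t u | lt t u =>
    obtain ⟨N, hN⟩ := tval_support S t
    obtain ⟨K, hK⟩ := tval_support S u
    refine ⟨max N K, fun w v v' h => ?_⟩
    simp only [Sat]
    rw [hN v v' fun i hi => h i (by omega), hK v v' fun i hi => h i (by omega)]
  | mem t i =>
    obtain ⟨N, hN⟩ := tval_support S t
    refine ⟨N, fun w v v' h => ?_⟩
    simp only [Sat]
    rw [hN v v' h]
  | not φ ih =>
    obtain ⟨N, hN⟩ := ih
    exact ⟨N, fun w v v' h => not_congr (hN w v v' h)⟩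
  | and φ ψ ih ih' | or φ ψ ih ih' | imp φ ψ ih ih' =>
    obtain ⟨N, hN⟩ := ih
    obtain ⟨K, hK⟩ := ih'
    refine ⟨max N K, fun w v v' h => ?_⟩
    have h1 := hN w v v' fun i hi => h i (by omega)
    have h2 := hK w v v' fun i hi => h i (by omega)
    simp only [Sat]
    simp only at h1 h2
    rw [h1, h2]
  | all x φ ih =>
    obtain ⟨N, hN⟩ := ih
    exact ⟨N, fun w v v' h => forall_congr' fun m => hN w _ _ (upd_agree h x m)⟩
  | ex x φ ih =>
    obtain ⟨N, hN⟩ := ih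
    exact ⟨N, fun w v v' h => exists_congr fun m => hN w _ _ (upd_agree h x m)⟩
  | ball x t φ ih =>
    obtain ⟨N, hN⟩ := ih
    obtain ⟨K, hK⟩ := tval_support S t
    refine ⟨max N K, fun w v v' h => ?_⟩
    simp only [Sat]
    rw [hK v v' fun i hi => h i (by omega)]
    exact forall_congr' fun m => imp_congr_right fun _ =>
      hN w _ _ (upd_agree (fun i hi => h i (by omega)) x m)
  | bex x t φ ih =>
    obtain ⟨N, hN⟩ := ih
    obtain ⟨K, hK⟩ := tval_support S t
    refine ⟨max N K, fun w v v' h => ?_⟩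
    simp only [Sat]
    rw [hK v v' fun i hi => h i (by omega)]
    exact exists_congr fun m => and_congr_right fun _ =>
      hN w _ _ (upd_agree (fun i hi => h i (by omega)) x m)
  | sall j φ ih =>
    obtain ⟨N, hN⟩ := ih
    exact ⟨N, fun w v v' h => forall_congr' fun A => imp_congr_right fun _ => hN _ v v' h⟩
  | sex j φ ih =>
    obtain ⟨N, hN⟩ := ih
    exact ⟨N, fun w v v' h => exists_congr fun A => and_congr_right fun _ => hN _ v v' h⟩

theorem sat0_support (S : Str) (φ : Fml) : ∃ N, SupportedBelow N fun v => Sat0 S v φ :=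
  (sat_support S ∅ φ).imp fun _ h => h _

/-- Renaming of variables in a term. -/
def Term.rename (f : ℕ → ℕ) : Term → Term
  | .var i => .var (f i)
  | .zero => .zero
  | .one => .one
  | .add t u => .add (t.rename f) (u.rename f)
  | .mul t u => .mul (t.rename f) (u.rename f)

theorem tval_rename (S : Str) (f : ℕ → ℕ) (v : ℕ → S.M) (t : Term) :
    tval S v (t.rename f) = tval S (fun i => v (f i)) t := by
  induction t with
  | var i => rfl
  | zero => rfl
  | one => rfl
  | add t u iht ihu => simp only [Term.rename, tval, iht, ihu]
  | mul t u iht ihu => simp only [Term.rename, tval, iht, ihu]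

theorem SupportedBelow.exists_fresh {α : Type} {N : ℕ} {R : (ℕ → α) → Prop}
    (h : SupportedBelow N R) (f : ℕ → ℕ) (x : ℕ) :
    ∃ z, ∀ (v : ℕ → α) (m : α),
      R (fun i => upd v z m (upd f x z i)) ↔ R (upd (fun i => v (f i)) x m) := by
  refine ⟨(Finset.range N).sup f + 1, fun v m => h _ _ fun i hi => ?_⟩
  have h1 : f i ≤ (Finset.range N).sup f := Finset.le_sup (Finset.mem_range.2 hi)
  by_cases hx : i = x
  · simp [upd, hx]
  · have : f i ≠ (Finset.range N).sup f + 1 := by omega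
    simp [upd, hx, this]

theorem Delta0.exists_rename (S : Str) {φ : Fml} (h : Delta0 φ) : ∀ f : ℕ → ℕ,
    ∃ φ', Delta0 φ' ∧ ∀ v : ℕ → S.M, Sat0 S v φ' ↔ Sat0 S (fun i => v (f i)) φ := by
  induction h with
  | eq t u =>
    intro f
    exact ⟨_, .eq (t.rename f) (u.rename f), fun v => by simp [Sat0, Sat, tval_rename]⟩
  | lt t u =>
    intro f
    exact ⟨_, .lt (t.rename f) (u.rename f), fun v => by simp [Sat0, Sat, tval_rename]⟩
  | not _ ih =>
    intro f
    obtain ⟨φ', hφ, e⟩ := ih f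
    exact ⟨_, .not hφ, fun v => not_congr (e v)⟩
  | and _ _ ih ih' =>
    intro f
    obtain ⟨φ', hφ, e⟩ := ih f
    obtain ⟨ψ', hψ, e'⟩ := ih' f
    exact ⟨_, .and hφ hψ, fun v => and_congr (e v) (e' v)⟩
  | or _ _ ih ih' =>
    intro f
    obtain ⟨φ', hφ, e⟩ := ih f
    obtain ⟨ψ', hψ, e'⟩ := ih' f
    exact ⟨_, .or hφ hψ, fun v => or_congr (e v) (e' v)⟩
  | imp _ _ ih ih' =>
    intro f
    obtain ⟨φ', hφ, e⟩ := ih f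
    obtain ⟨ψ', hψ, e'⟩ := ih' f
    exact ⟨_, .imp hφ hψ, fun v => imp_congr (e v) (e' v)⟩
  | @ball x t φ _ ih =>
    intro f
    obtain ⟨N, hN⟩ := sat0_support S φ
    obtain ⟨z, hz⟩ := hN.exists_fresh f x
    obtain ⟨φ', hφ, e⟩ := ih (upd f x z)
    refine ⟨_, .ball z (t.rename f) hφ, fun v => ?_⟩
    simp only [Sat0, Sat, tval_rename]
    exact forall_congr' fun m => imp_congr_right fun _ => (e _).trans (hz v m)
  | @bex x t φ _ ih =>
    intro f
    obtain ⟨N, hN⟩ := sat0_support S φ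
    obtain ⟨z, hz⟩ := hN.exists_fresh f x
    obtain ⟨φ', hφ, e⟩ := ih (upd f x z)
    refine ⟨_, .bex z (t.rename f) hφ, fun v => ?_⟩
    simp only [Sat0, Sat, tval_rename]
    exact exists_congr fun m => and_congr_right fun _ => (e _).trans (hz v m)

/-- Predicates on valuations that are `Σₖ`-definable by a formula with one quantifier in each
unbounded block. -/
def SigmaDef (S : Str) : ℕ → ((ℕ → S.M) → Prop) → Prop
  | 0, R => ∃ φ, Delta0 φ ∧ ∀ v, Sat0 S v φ ↔ R v
  | k + 1, R => ∃ Q : (ℕ → S.M) → Prop, SigmaDef S k (fun v => ¬ Q v) ∧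
      ∀ v, R v ↔ ∃ m, Q (scons m v)

/-- Predicates on valuations whose negation is `Σₖ`-definable. -/
abbrev PiDef (S : Str) (k : ℕ) (R : (ℕ → S.M) → Prop) : Prop := SigmaDef S k fun v => ¬ R v

section Closure

variable {S : Str} {k : ℕ} {R R' : (ℕ → S.M) → Prop}

theorem SigmaDef.congr (h : SigmaDef S k R) (e : ∀ v, R v ↔ R' v) : SigmaDef S k R' := by
  rwa [← (funext fun v => propext (e v) : R = R')]

theorem SigmaDef.rename (h : SigmaDef S k R) (f : ℕ → ℕ) :
    SigmaDef S k fun v => R fun i => v (f i) := by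
  induction k generalizing R f with
  | zero =>
    obtain ⟨φ, hφ, e⟩ := h
    obtain ⟨φ', hφ', e'⟩ := hφ.exists_rename S f
    exact ⟨φ', hφ', fun v => (e' v).trans (e _)⟩
  | succ k ih =>
    obtain ⟨Q, hQ, e⟩ := h
    refine ⟨fun v => Q fun i => v (liftRen f i), ih hQ _, fun v => ?_⟩
    simp only [e, scons_comp]

theorem PiDef.not (h : PiDef S k R) : SigmaDef S k fun v => ¬ R v := h

theorem SigmaDef.not (h : SigmaDef S k R) : PiDef S k fun v => ¬ R v :=
  h.congr fun _ => not_not.symm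

theorem SigmaDef.zero_not (h : SigmaDef S 0 R) : SigmaDef S 0 fun v => ¬ R v := by
  obtain ⟨φ, hφ, e⟩ := h
  exact ⟨_, .not hφ, fun v => not_congr (e v)⟩

theorem PiDef.succ_sigma (h : PiDef S k R) : SigmaDef S (k + 1) R := by
  refine ⟨fun v => R fun i => v (i + 1), h.rename Nat.succ, fun v => ?_⟩
  exact ⟨fun hv => ⟨v 0, hv⟩, fun ⟨_, hv⟩ => hv⟩

theorem SigmaDef.succ (h : SigmaDef S k R) : SigmaDef S (k + 1) R := by
  induction k generalizing R with
  | zero => exact PiDef.succ_sigma h.zero_not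
  | succ k ih =>
    obtain ⟨Q, hQ, e⟩ := h
    exact ⟨Q, ih hQ, e⟩

theorem SigmaDef.mono {j : ℕ} (h : SigmaDef S j R) (hjk : j ≤ k) : SigmaDef S k R := by
  induction hjk with
  | refl => exact h
  | step _ ih => exact ih.succ

theorem sigmaDef_lt (i j : ℕ) : SigmaDef S k fun v => S.lt (v i) (v j) :=
  SigmaDef.mono (j := 0) ⟨_, .lt (.var i) (.var j), fun _ => Iff.rfl⟩ (Nat.zero_le k)

theorem sigmaDef_add_ne (i j l : ℕ) : SigmaDef S k fun v => ¬ S.add (v i) (v j) = v l :=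
  SigmaDef.mono (j := 0) ⟨_, .not (.eq (.add (.var i) (.var j)) (.var l)), fun _ => Iff.rfl⟩
    (Nat.zero_le k)

/-- Definable predicates are definable by formulas of the corresponding syntactic classes. -/
theorem SigmaDef.exists_formula (k : ℕ) : ∀ R : (ℕ → S.M) → Prop, SigmaDef S k R →
    (∃ φ, IsSigma k φ ∧ ∀ v, Sat0 S v φ ↔ R v) ∧ (∃ φ, IsPi k φ ∧ ∀ v, Sat0 S v φ ↔ ¬ R v) := by
  induction k with
  | zero =>
    rintro R ⟨φ, hφ, e⟩
    exact ⟨⟨φ, .delta0 hφ, e⟩, ⟨_, .delta0 (.not hφ), fun v => not_congr (e v)⟩⟩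
  | succ k ih =>
    rintro R ⟨Q, hQ, e⟩
    obtain ⟨⟨χ, -, eχ⟩, -⟩ := ih _ hQ
    obtain ⟨N, hN⟩ := sat0_support S χ
    obtain ⟨⟨φ, hφ, eφ⟩, ⟨ψ, hψ, eψ⟩⟩ := ih _ (hQ.rename (unscons N))
    have key : ∀ v m, ¬ Q (fun i => upd v N m (unscons N i)) ↔ ¬ Q (scons m v) := fun v m =>
      (eχ _).symm.trans ((hN.upd_unscons v m).trans (eχ _))
    refine ⟨⟨_, .ex N (.ofPi hψ), fun v => ?_⟩, ⟨_, .all N (.ofSigma hφ), fun v => ?_⟩⟩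
    · rw [e]
      exact exists_congr fun m => (eψ _).trans ((not_congr (key v m)).trans not_not)
    · rw [e, not_exists]
      exact forall_congr' fun m => (eφ _).trans (key v m)

/-- Closure of the `Σₖ`-definable predicates under positive connectives and bounded
quantifiers. -/
structure SigmaClosed (S : Str) (k : ℕ) : Prop where
  and : ∀ {R R' : (ℕ → S.M) → Prop}, SigmaDef S k R → SigmaDef S k R' →
    SigmaDef S k fun v => R v ∧ R' v
  or : ∀ {R R' : (ℕ → S.M) → Prop}, SigmaDef S k R → SigmaDef S k R' →
    SigmaDef S k fun v => R v ∨ R' v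
  ball : ∀ (i : ℕ) {R : (ℕ → S.M) → Prop}, SigmaDef S k R →
    SigmaDef S k fun v => ∀ m, S.lt m (v i) → R (scons m v)
  bex : ∀ (i : ℕ) {R : (ℕ → S.M) → Prop}, SigmaDef S k R →
    SigmaDef S k fun v => ∃ m, S.lt m (v i) ∧ R (scons m v)

theorem sigmaClosed_zero (S : Str) : SigmaClosed S 0 where
  and := by
    rintro R R' ⟨φ, hφ, e⟩ ⟨φ', hφ', e'⟩
    exact ⟨_, .and hφ hφ', fun v => and_congr (e v) (e' v)⟩
  or := by
    rintro R R' ⟨φ, hφ, e⟩ ⟨φ', hφ', e'⟩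
    exact ⟨_, .or hφ hφ', fun v => or_congr (e v) (e' v)⟩
  ball := by
    rintro i R h
    obtain ⟨χ, -, eχ⟩ := id h
    obtain ⟨N, hN⟩ := sat0_support S χ
    obtain ⟨φ, hφ, e⟩ := h.rename (unscons N)
    exact ⟨_, .ball N (.var i) hφ, fun v => forall_congr' fun m => imp_congr_right fun _ =>
      (e _).trans ((eχ _).symm.trans ((hN.upd_unscons v m).trans (eχ _)))⟩
  bex := by
    rintro i R h
    obtain ⟨χ, -, eχ⟩ := id h
    obtain ⟨N, hN⟩ := sat0_support S χ
    obtain ⟨φ, hφ, e⟩ := h.rename (unscons N)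
    exact ⟨_, .bex N (.var i) hφ, fun v => exists_congr fun m => and_congr_right fun _ =>
      (e _).trans ((eχ _).symm.trans ((hN.upd_unscons v m).trans (eχ _)))⟩

namespace SigmaClosed

variable (C : SigmaClosed S k)
include C

theorem piAnd (h : PiDef S k R) (h' : PiDef S k R') : PiDef S k fun v => R v ∧ R' v :=
  (C.or h h').congr fun _ => not_and_or.symm

theorem piOr (h : PiDef S k R) (h' : PiDef S k R') : PiDef S k fun v => R v ∨ R' v :=
  (C.and h h').congr fun _ => not_or.symm

theorem piBall (i : ℕ) (h : PiDef S k R) :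
    PiDef S k fun v => ∀ m, S.lt m (v i) → R (scons m v) :=
  (C.bex i h).congr fun v => by push Not; rfl

theorem piBex (i : ℕ) (h : PiDef S k R) :
    PiDef S k fun v => ∃ m, S.lt m (v i) ∧ R (scons m v) :=
  (C.ball i h).congr fun v => by push Not; rfl

theorem succ_or (h : SigmaDef S (k + 1) R) (h' : SigmaDef S (k + 1) R') :
    SigmaDef S (k + 1) fun v => R v ∨ R' v := by
  obtain ⟨Q, hQ, e⟩ := h
  obtain ⟨Q', hQ', e'⟩ := h'
  exact ⟨fun v => Q v ∨ Q' v, C.piOr hQ hQ', fun v => by simp only [e, e', exists_or]⟩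

end SigmaClosed

end Closure

section Peano

variable {S : Str} (hS : PAminus S)
include hS

theorem PAminus.lt_succ (a : S.M) : S.lt a (S.add a S.one) := by
  have := hS.add_lt_add _ _ a hS.zero_lt_one
  rwa [hS.add_comm, hS.add_zero, hS.add_comm] at this

theorem PAminus.not_lt_zero (a : S.M) : ¬ S.lt a S.zero := by
  intro h
  rcases hS.zero_le a with rfl | h'
  · exact hS.lt_irrefl _ h
  · exact hS.lt_irrefl _ (hS.lt_trans _ _ _ h h')

theorem PAminus.lt_succ_iff {a b : S.M} : S.lt a (S.add b S.one) ↔ S.lt a b ∨ a = b := by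
  constructor
  · intro h
    rcases hS.lt_total a b with h' | h' | h'
    · exact .inl h'
    · exact .inr h'
    · rcases hS.discrete _ _ h' with h'' | h''
      · exact absurd (h'' ▸ h) (hS.lt_irrefl _)
      · exact absurd (hS.lt_trans _ _ _ h h'') (hS.lt_irrefl _)
  · rintro (h | rfl)
    · exact hS.lt_trans _ _ _ h (hS.lt_succ b)
    · exact hS.lt_succ a

theorem PAminus.eq_zero_or_succ (a : S.M) : a = S.zero ∨ ∃ b, S.add b S.one = a :=
  (hS.zero_le a).imp id (hS.pred a)

/-- Any two elements have a common strict upper bound whose lower set contains those of both. -/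
theorem PAminus.exists_upper (a b : S.M) :
    ∃ c, S.lt a c ∧ S.lt b c ∧ (∀ x, S.lt x a → S.lt x c) ∧ ∀ x, S.lt x b → S.lt x c := by
  obtain ⟨c, ha, hb⟩ : ∃ c, S.lt a c ∧ S.lt b c := by
    rcases hS.lt_total a b with h | rfl | h
    · exact ⟨_, hS.lt_trans _ _ _ h (hS.lt_succ b), hS.lt_succ b⟩
    · exact ⟨_, hS.lt_succ a, hS.lt_succ a⟩
    · exact ⟨_, hS.lt_succ a, hS.lt_trans _ _ _ h (hS.lt_succ a)⟩
  exact ⟨c, ha, hb, fun x hx => hS.lt_trans _ _ _ hx ha, fun x hx => hS.lt_trans _ _ _ hx hb⟩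

end Peano

/-- Induction for `Σₖ`-definable predicates, in the first variable. -/
def SigmaInd (S : Str) (k : ℕ) : Prop :=
  ∀ R, SigmaDef S k R → ∀ v, R (scons S.zero v) →
    (∀ m, R (scons m v) → R (scons (S.add m S.one) v)) → ∀ m, R (scons m v)

theorem SigmaInd.mono {S : Str} {j k : ℕ} (h : SigmaInd S k) (hjk : j ≤ k) : SigmaInd S j :=
  fun R hR => h R (hR.mono hjk)

namespace SigmaClosed

variable {S : Str} {k : ℕ} {R R' Q : (ℕ → S.M) → Prop} (C : SigmaClosed S k) (hS : PAminus S)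
include C hS

theorem succ_ex (h : SigmaDef S (k + 1) R) : SigmaDef S (k + 1) fun v => ∃ x, R (scons x v) := by
  obtain ⟨Q, hQ, e⟩ := h
  refine ⟨_, C.piBex 0 (C.piBex 1 (hQ.rename (liftRen (liftRen Nat.succ)))), fun v => ?_⟩
  simp only [scons_comp, e]
  constructor
  · rintro ⟨x, m, h⟩
    obtain ⟨b, hx, hm, -⟩ := hS.exists_upper x m
    exact ⟨b, x, hx, m, hm, h⟩
  · rintro ⟨b, x, hx, m, hm, h⟩
    exact ⟨x, m, h⟩

theorem succ_and (h : SigmaDef S (k + 1) R) (h' : SigmaDef S (k + 1) R') :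
    SigmaDef S (k + 1) fun v => R v ∧ R' v := by
  obtain ⟨Q, hQ, e⟩ := h
  obtain ⟨Q', hQ', e'⟩ := h'
  refine ⟨_, C.piAnd (C.piBex 0 (hQ.rename (liftRen Nat.succ)))
    (C.piBex 0 (hQ'.rename (liftRen Nat.succ))), fun v => ?_⟩
  simp only [scons_comp, e, e']
  constructor
  · rintro ⟨⟨x, h⟩, m, h'⟩
    obtain ⟨b, hx, hm, -⟩ := hS.exists_upper x m
    exact ⟨b, ⟨x, hx, h⟩, m, hm, h'⟩
  · rintro ⟨b, ⟨x, hx, h⟩, m, hm, h'⟩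
    exact ⟨⟨x, h⟩, m, h'⟩

/-- Collection for `Πₖ`-definable predicates, from `Σₖ₊₁`-induction. -/
theorem collection (hI : SigmaInd S (k + 1)) (hQ : PiDef S k Q) (v : ℕ → S.M) (a : S.M)
    (h : ∀ x, S.lt x a → ∃ m, Q (scons m (scons x v))) :
    ∃ b, ∀ x, S.lt x a → ∃ m, S.lt m b ∧ Q (scons m (scons x v)) := by
  have hR : SigmaDef S (k + 1) fun w => ∃ b, ∀ x, S.lt x (w 1) →
      (¬ S.lt x (w 0) ∨ ∃ m, S.lt m b ∧ Q (scons m (scons x fun i => w (i + 2)))) := by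
    refine ⟨_, C.piBall 2 (C.piOr (R := fun w => ¬ S.lt (w 0) (w 2))
      (sigmaDef_lt 0 2 |>.congr fun _ => not_not.symm)
      (C.piBex 1 (hQ.rename (liftRen (liftRen (· + 3)))))), fun w => ?_⟩
    simp only [scons_comp]
    rfl
  obtain ⟨b, hb⟩ := hI _ hR (scons a v)
    ⟨S.zero, fun x _ => .inl (hS.not_lt_zero x)⟩ (by
      rintro z ⟨b, hb⟩
      change ∀ x, S.lt x a → (¬ S.lt x z ∨ ∃ m, S.lt m b ∧ Q (scons m (scons x v))) at hb
      change ∃ b, ∀ x, S.lt x a →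
        (¬ S.lt x (S.add z S.one) ∨ ∃ m, S.lt m b ∧ Q (scons m (scons x v)))
      obtain ⟨m, hm⟩ : ∃ m, S.lt z a → Q (scons m (scons z v)) := by
        by_cases hz : S.lt z a
        · exact (h z hz).imp fun m hm _ => hm
        · exact ⟨b, fun h' => absurd h' hz⟩
      obtain ⟨c, hmc, -, -, hc⟩ := hS.exists_upper m b
      refine ⟨c, fun x hx => or_iff_not_imp_left.2 fun hxz => ?_⟩
      rcases hS.lt_succ_iff.1 (not_not.1 hxz) with hxz | rfl
      · obtain ⟨y, hy, hQy⟩ := (hb x hx).resolve_left (not_not.2 hxz)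
        exact ⟨y, hc y hy, hQy⟩
      · exact ⟨m, hmc, hm hx⟩) a
  exact ⟨b, fun x hx => (hb x hx).resolve_left (not_not.2 hx)⟩

theorem succ_ball (hI : SigmaInd S (k + 1)) (i : ℕ) (h : SigmaDef S (k + 1) R) :
    SigmaDef S (k + 1) fun v => ∀ m, S.lt m (v i) → R (scons m v) := by
  obtain ⟨Q, hQ, e⟩ := h
  refine ⟨_, C.piBall (i + 1) (C.piBex 1 (hQ.rename (liftRen (liftRen Nat.succ)))), fun v => ?_⟩
  simp only [scons_comp, e]
  constructor
  · exact C.collection hS hI hQ v (v i)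
  · rintro ⟨b, hb⟩ x hx
    obtain ⟨m, -, hm⟩ := hb x hx
    exact ⟨m, hm⟩

theorem succ (hI : SigmaInd S (k + 1)) : SigmaClosed S (k + 1) where
  and := C.succ_and hS
  or := C.succ_or
  ball i _ h := C.succ_ball hS hI i h
  bex i _ h := C.succ_ex hS (C.succ_and hS (sigmaDef_lt 0 (i + 1)) h)

end SigmaClosed

theorem SigmaInd.sigmaClosed {S : Str} {k : ℕ} (hS : PAminus S) (hI : SigmaInd S k) :
    SigmaClosed S k := by
  induction k with
  | zero => exact sigmaClosed_zero S
  | succ k ih => exact (ih (hI.mono k.le_succ)).succ hS hI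

mutual

/-- `Σₙ` formulas define `Σₙ`-definable predicates. -/
theorem IsSigma.sigmaDef {S : Str} (hS : PAminus S) : ∀ {n : ℕ} {φ : Fml}, IsSigma n φ →
    (∀ j < n, SigmaClosed S j) → SigmaDef S n fun v => Sat0 S v φ
  | n, φ, .delta0 h, _ => SigmaDef.mono (j := 0) ⟨φ, h, fun _ => Iff.rfl⟩ (Nat.zero_le n)
  | n + 1, _, .ofPi h, C => (IsPi.piDef hS h fun j hj => C j (by omega)).succ_sigma
  | n + 1, _, .ex x h, C =>
    ((C n n.lt_succ_self).succ_ex hS ((IsSigma.sigmaDef hS h C).rename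
      fun i => if i = x then 0 else i + 1)).congr fun v => by
        simp only [upd_comp_rename]
        rfl

/-- `Πₙ` formulas define `Πₙ`-definable predicates. -/
theorem IsPi.piDef {S : Str} (hS : PAminus S) : ∀ {n : ℕ} {φ : Fml}, IsPi n φ →
    (∀ j < n, SigmaClosed S j) → PiDef S n fun v => Sat0 S v φ
  | n, _, .delta0 h, _ => SigmaDef.mono (j := 0) ⟨_, .not h, fun _ => Iff.rfl⟩ (Nat.zero_le n)
  | n + 1, _, .ofSigma h, C =>
    PiDef.succ_sigma (IsSigma.sigmaDef hS h fun j hj => C j (by omega)).not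
  | n + 1, _, .all x h, C =>
    ((C n n.lt_succ_self).succ_ex hS ((IsPi.piDef hS h C).rename
      fun i => if i = x then 0 else i + 1)).congr fun v => by
        simp only [upd_comp_rename]
        exact not_forall.symm

end

/-- Weak regularity for conjunctions of a `Σₖ`-definable and a `Πₖ`-definable predicate. -/
def SigmaPiWR (S : Str) (k : ℕ) : Prop :=
  ∀ A B, SigmaDef S k A → PiDef S k B → ∀ v a,
    (∀ m, ∃ x, S.lt x a ∧ A (scons m (scons x v)) ∧ B (scons m (scons x v))) →
    ∃ x, S.lt x a ∧ ∀ b, ∃ m, S.lt b m ∧ A (scons m (scons x v)) ∧ B (scons m (scons x v))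

theorem SigmaPiWR.of_WRFor {S : Str} {k n : ℕ} (h : WRFor S (SigmaAndPi n)) (hk : k ≤ n) :
    SigmaPiWR S k := by
  intro A B hA hB v a H
  obtain ⟨ψ, hψ, eψ⟩ := (SigmaDef.exists_formula n A (hA.mono hk)).1
  obtain ⟨χ, hχ, eχ⟩ := (SigmaDef.exists_formula n _ (hB.mono hk)).2
  have key : ∀ m x, Sat0 S (upd (upd (scons a (scons a v)) 0 m) 1 x) (.and ψ χ) ↔
      A (scons m (scons x v)) ∧ B (scons m (scons x v)) := by
    intro m x
    rw [upd_scons_scons]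
    exact and_congr (eψ _) ((eχ _).trans not_not)
  have := h _ ⟨ψ, χ, hψ, hχ, rfl⟩ (scons a (scons a v)) 0 1 (by omega) a
  simp only [key] at this
  exact this H

theorem SigmaInd.of_indFor_delta0 {S : Str} (h : IndFor S Delta0) : SigmaInd S 0 := by
  rintro R ⟨φ, hφ, e⟩ v
  have := h φ hφ (scons S.zero v) 0
  simpa only [upd_scons_zero, e] using this

theorem SigmaInd.of_indFor {S : Str} {k : ℕ} (h : IndFor S (IsSigma k)) : SigmaInd S k := by
  intro R hR v
  obtain ⟨φ, hφ, e⟩ := (SigmaDef.exists_formula k R hR).1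
  have := h φ hφ (scons S.zero v) 0
  simpa only [upd_scons_zero, e] using this

theorem SigmaInd.indFor {S : Str} {k : ℕ} (hS : PAminus S) (h : SigmaInd S k) :
    IndFor S (IsSigma k) := by
  intro φ hφ v x
  have := h _ ((hφ.sigmaDef hS fun j hj => (h.mono hj.le).sigmaClosed hS).rename
    fun i => if i = x then 0 else i + 1) v
  simpa only [upd_comp_rename] using this

/-- Induction climbs one level of the arithmetic hierarchy by weak regularity: colour `m` by the
least `x` for which `x` has no witness below `m`. -/
theorem SigmaInd.succ_of_WR {S : Str} {k : ℕ} (hS : PAminus S) (hI : SigmaInd S k)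
    (hW : SigmaPiWR S k) : SigmaInd S (k + 1) := by
  rintro R ⟨Q, hQ, e⟩ v h0 hs a
  by_contra ha
  have C := hI.sigmaClosed hS
  have hA : SigmaDef S k fun w =>
      ∀ y, S.lt y (w 0) → ¬ Q (scons y fun i => w (i + 1)) := by
    refine (C.ball 0 (PiDef.not hQ |>.rename (liftRen Nat.succ))).congr fun w => ?_
    simp only [scons_comp]
  have hB : PiDef S k fun w => ∀ x', S.lt x' (w 1) →
      ∃ y, S.lt y (w 0) ∧ Q (scons y (scons x' fun i => w (i + 2))) := by
    refine (C.piBall 1 (C.piBex 1 (hQ.rename (liftRen (liftRen (· + 2)))))).congr fun w => ?_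
    simp only [scons_comp]
    rfl
  obtain ⟨x, -, hx⟩ := hW _ _ hA hB v (S.add a S.one) (by
    intro m
    change ∃ x, S.lt x (S.add a S.one) ∧ (∀ y, S.lt y m → ¬ Q (scons y (scons x v))) ∧
      (∀ x', S.lt x' x → ∃ y, S.lt y m ∧ Q (scons y (scons x' v)))
    by_contra! hno
    have step : ∀ x, S.lt x (S.add a S.one) →
        (∀ x', S.lt x' x → ∃ y, S.lt y m ∧ Q (scons y (scons x' v))) →
        ∃ y, S.lt y m ∧ Q (scons y (scons x v)) := by
      intro x hx hlow
      by_contra! hy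
      obtain ⟨x', hx', h'⟩ := hno x hx hy
      obtain ⟨y, hy, hQy⟩ := hlow x' hx'
      exact h' y hy hQy
    have hθ : SigmaDef S k fun w => ∀ x, S.lt x (w 2) → (¬ S.add x (w 0) = w 3 ∨
        ∃ x', S.lt x' x ∧ ∀ y, S.lt y (w 1) → ¬ Q (scons y (scons x' fun i => w (i + 4)))) := by
      refine (C.ball 2 (C.or (sigmaDef_add_ne 0 1 4) (C.bex 0 (C.ball 3
        (PiDef.not hQ |>.rename (liftRen (liftRen (· + 5)))))))).congr fun w => ?_
      simp only [scons_comp]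
      rfl
    have hall := hI _ hθ (scons m (scons (S.add a S.one) (scons a v)))
    change (∀ x, S.lt x (S.add a S.one) → (¬ S.add x S.zero = a ∨
        ∃ x', S.lt x' x ∧ ∀ y, S.lt y m → ¬ Q (scons y (scons x' v)))) →
      (∀ z, (∀ x, S.lt x (S.add a S.one) → (¬ S.add x z = a ∨
        ∃ x', S.lt x' x ∧ ∀ y, S.lt y m → ¬ Q (scons y (scons x' v)))) →
        (∀ x, S.lt x (S.add a S.one) → (¬ S.add x (S.add z S.one) = a ∨
        ∃ x', S.lt x' x ∧ ∀ y, S.lt y m → ¬ Q (scons y (scons x' v))))) →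
      ∀ z, (∀ x, S.lt x (S.add a S.one) → (¬ S.add x z = a ∨
        ∃ x', S.lt x' x ∧ ∀ y, S.lt y m → ¬ Q (scons y (scons x' v)))) at hall
    have hfin := hall
      (by
        intro x hx
        refine or_iff_not_imp_left.2 fun hxa => ?_
        rw [not_not, hS.add_zero] at hxa
        subst hxa
        by_contra! hlow
        obtain ⟨y, -, hy⟩ := step x hx hlow
        exact ha ((e _).2 ⟨y, hy⟩))
      (by
        intro z hz x hx
        refine or_iff_not_imp_left.2 fun hxa => ?_
        rw [not_not] at hxa
        by_contra! hlow
        have hxlt : S.lt x a := by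
          have := hS.add_lt_add _ _ x (hS.lt_succ_iff.2 ((hS.zero_le z).symm.imp id Eq.symm))
          rwa [hS.add_comm, hS.add_zero, hS.add_comm, hxa] at this
        have hxz : S.add (S.add x S.one) z = a := by
          rw [hS.add_assoc, hS.add_comm S.one, hxa]
        obtain ⟨x', hx', hno'⟩ :=
          (hz _ (hS.add_lt_add _ _ _ hxlt)).resolve_left (not_not.2 hxz)
        obtain ⟨y, hy, hQy⟩ : ∃ y, S.lt y m ∧ Q (scons y (scons x' v)) := by
          rcases hS.lt_succ_iff.1 hx' with hx' | rfl
          · exact hlow x' hx'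
          · exact step x' hx hlow
        exact hno' y hy hQy)
      a S.zero (hS.lt_succ_iff.2 ((hS.zero_le a).symm.imp id Eq.symm))
    rcases hfin with h | ⟨x', hx', -⟩
    · exact h (by rw [hS.add_comm, hS.add_zero])
    · exact hS.not_lt_zero _ hx')
  replace hx : ∀ b, ∃ m, S.lt b m ∧ (∀ y, S.lt y m → ¬ Q (scons y (scons x v))) ∧
      (∀ x', S.lt x' x → ∃ y, S.lt y m ∧ Q (scons y (scons x' v))) := hx
  have hnot : ¬ R (scons x v) := by
    rw [e]
    rintro ⟨y, hy⟩
    obtain ⟨m, hm, hno, -⟩ := hx y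
    exact hno y hm hy
  rcases hS.eq_zero_or_succ x with rfl | ⟨x', rfl⟩
  · exact hnot h0
  · obtain ⟨m, -, -, hm⟩ := hx S.zero
    obtain ⟨y, -, hy⟩ := hm x' (hS.lt_succ x')
    exact hnot (hs x' ((e _).2 ⟨y, hy⟩))

/-- Lemma `lem:rpi->B2`.
For each `n ∈ ℕ`, `WR(Σₙ ∧ Πₙ) ⊢ IΣₙ₊₁`: every model of `IΔ₀` satisfying
the weak regularity principle for all conjunctions of a `Σₙ` and a `Πₙ`
formula satisfies `Σₙ₊₁`-induction.  Moreover, for each `k ≤ n`,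
`IΣₖ + WR(Σₙ ∧ Πₙ) ⊢ IΣₖ₊₁`. -/
theorem statement_14 (n : ℕ) (S : Str) :
    ((IDelta0 S ∧ WRFor S (SigmaAndPi n)) → ISigma S (n + 1)) ∧
    (∀ k : ℕ, k ≤ n →
      (ISigma S k ∧ WRFor S (SigmaAndPi n)) → ISigma S (k + 1)) := by
  have climb : ∀ j k : ℕ, j ≤ k → k ≤ n + 1 → PAminus S → WRFor S (SigmaAndPi n) →
      SigmaInd S j → SigmaInd S k := by
    intro j k hjk hk hS hW hI
    induction k, hjk using Nat.le_induction with
    | base => exact hI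
    | succ k _ ih =>
      exact (ih (by omega)).succ_of_WR hS (SigmaPiWR.of_WRFor hW (by omega))
  constructor
  · rintro ⟨⟨hS, hI⟩, hW⟩
    exact ⟨hS, (climb 0 (n + 1) (by omega) le_rfl hS hW (.of_indFor_delta0 hI)).indFor hS⟩
  · rintro k hk ⟨⟨hS, hI⟩, hW⟩
    exact ⟨hS, (climb k (k + 1) (by omega) (by omega) hS hW (.of_indFor hI)).indFor hS⟩

end PaperArith
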